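/- Let d ≥ 2 be an integer, let r and r' be purely imaginary complex numbers, and let t > 0 be real. Then Ψ^d(r,r',t) = 2^{4−d−4t−r−r'} · π^{2−3t} · Γ(t+r+r') · Γ((d−1)/2+t+r−2r') · Γ((d−1)/2+t+r'−2r) · Γ(d−1+t+r+r') · Γ(t/2−r−r') / Γ(3t/2). (Stade's formula for generalized principal series Whittaker functions on GL(3).) -/

import Mathlib

open Complex Real Set MeasureTheory Finset

/-- The beta function `B(u,v) = Γ(u)Γ(v)/Γ(u+v)`. -/
noncomputable def cBeta (u v : ℂ) : ℂ := Complex.Gamma u * Complex.Gamma v / Complex.Gamma (u + v)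

/-- The completed Whittaker function `W^{d*}_{m'}(y, r)`, defined via its Mellin-Barnes
integral with the contours placed at `σ₁ = σ₂ = 1`. -/
noncomputable def Wstar (d : ℕ) (r : ℂ) (y₁ y₂ : ℝ) (m' : ℤ) : ℂ :=
  ((2 : ℂ) ^ (d + 1) * (Real.pi : ℂ))⁻¹ *
    (Real.sqrt ((2 * d).choose (d + m'.natAbs)) : ℂ) *
    ∑ ℓ ∈ Finset.range (m'.natAbs + 1),
      (if 0 ≤ m' then (1 : ℂ) else -1) ^ ℓ * ((m'.natAbs).choose ℓ : ℂ) *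
        (((2 * Real.pi : ℝ) : ℂ))⁻¹ ^ 2 *
          ∫ t : ℝ × ℝ,
            ((2 * Real.pi * y₁ : ℝ) : ℂ) ^ (1 - ((1 : ℂ) + Complex.I * t.1)) *
              ((2 * Real.pi * y₂ : ℝ) : ℂ) ^ (1 - ((1 : ℂ) + Complex.I * t.2)) *
                Complex.Gamma (((d : ℂ) - 1) / 2 + ((1 : ℂ) + Complex.I * t.1) - r) *
                  Complex.Gamma (((d : ℂ) - 1) / 2 + ((1 : ℂ) + Complex.I * t.2) + r) *
                    cBeta (((d : ℂ) - (m'.natAbs : ℂ) + ((1 : ℂ) + Complex.I * t.1) + 2 * r) / 2)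
                      (((ℓ : ℂ) + ((1 : ℂ) + Complex.I * t.2) - 2 * r) / 2)

/-- The Rankin-Selberg local zeta integral `Ψ^d(r, r', t)`. -/
noncomputable def Psi (d : ℕ) (r r' t : ℂ) : ℂ :=
  ∫ y₁ in Set.Ioi (0 : ℝ), ∫ y₂ in Set.Ioi (0 : ℝ),
    (∑ m' ∈ Finset.Icc (-(d : ℤ)) (d : ℤ), Wstar d r y₁ y₂ m' * Wstar d r' y₁ y₂ m') *
      ((y₁ ^ 2 * y₂ : ℝ) : ℂ) ^ t / ((y₁ * y₂ : ℝ) : ℂ) ^ 3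

theorem norm_Gamma_le_Gamma_re {s : ℂ} (hs : 0 < s.re) :
    ‖Complex.Gamma s‖ ≤ Real.Gamma s.re := by
  rw [Complex.Gamma_eq_integral hs, Real.Gamma_eq_integral hs, Complex.GammaIntegral]
  refine (norm_integral_le_integral_norm _).trans_eq ?_
  refine setIntegral_congr_fun measurableSet_Ioi fun x hx => ?_
  have hx : 0 < x := hx
  simp only [norm_mul, norm_cpow_eq_rpow_re_of_pos hx, Complex.norm_real, Real.norm_eq_abs,
    Real.abs_exp, sub_re, one_re]

theorem norm_Gamma_le_div {s : ℂ} (hs : 0 < s.re) :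
    ‖Complex.Gamma s‖ ≤ Real.Gamma (s.re + 2) / (s.re ^ 2 + s.im ^ 2) := by
  have h0 : s ≠ 0 := by rintro rfl; simp at hs
  have h1 : s + 1 ≠ 0 := by
    intro h
    have := congrArg Complex.re h
    simp at this; linarith
  have e : Complex.Gamma (s + 1 + 1) = (s + 1) * (s * Complex.Gamma s) := by
    rw [Complex.Gamma_add_one _ h1, Complex.Gamma_add_one _ h0]
  have b := norm_Gamma_le_Gamma_re (s := s + 1 + 1) (by simp; linarith)
  rw [e] at b
  simp only [norm_mul, add_re, one_re, add_assoc] at b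
  norm_num at b
  have hn : ‖s‖ ≤ ‖s + 1‖ := by
    rw [Complex.norm_def, Complex.norm_def]
    apply Real.sqrt_le_sqrt
    simp [Complex.normSq_apply]
    nlinarith
  have hsq : ‖s‖ ^ 2 = s.re ^ 2 + s.im ^ 2 := by
    rw [← Complex.normSq_eq_norm_sq, Complex.normSq_apply]; ring
  rw [le_div_iff₀ (by positivity), ← hsq]
  calc ‖Complex.Gamma s‖ * ‖s‖ ^ 2 = ‖s‖ * (‖s‖ * ‖Complex.Gamma s‖) := by ring
    _ ≤ ‖s + 1‖ * (‖s‖ * ‖Complex.Gamma s‖) := by gcongr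
    _ ≤ _ := b

theorem continuous_Gamma_vertical {c : ℂ} (hc : 0 < c.re) :
    Continuous fun t : ℝ => Complex.Gamma (c + I * t) := by
  refine continuous_iff_continuousAt.2 fun t => ?_
  refine ContinuousAt.comp (f := fun t : ℝ => c + I * t) (x := t)
    (Complex.differentiableAt_Gamma _ fun m h => ?_).continuousAt (by fun_prop)
  have := congrArg Complex.re h
  simp at this
  have : (0 : ℝ) ≤ m := by positivity
  linarith

theorem integrable_Gamma_vertical {c : ℂ} (hc : 0 < c.re) :
    Integrable fun t : ℝ => Complex.Gamma (c + I * t) := by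
  have h1 : Integrable fun t : ℝ =>
      (Real.Gamma (c.re + 2) / c.re ^ 2) * (1 + ((t + c.im) / c.re) ^ 2)⁻¹ :=
    ((integrable_inv_one_add_sq.comp_div hc.ne').comp_add_right c.im).const_mul _
  refine h1.mono' (continuous_Gamma_vertical hc).aestronglyMeasurable
    (Filter.Eventually.of_forall fun t => ?_)
  have := norm_Gamma_le_div (s := c + I * t) (by simpa using hc)
  refine this.trans_eq ?_
  simp
  field_simp
  ring

theorem integral_cpow_mul_Gamma_vertical {c : ℂ} (hc : 0 < c.re) {x : ℝ} (hx : 0 < x) :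
    ∫ t : ℝ, (x : ℂ) ^ (-(I * t)) * Complex.Gamma (c + I * t) =
      2 * π * ((x : ℂ) ^ c * Complex.exp (-x)) := by
  let f : ℝ → ℂ := fun x => (x : ℂ) ^ c * Complex.exp (-x)
  have hm : ∀ s : ℂ, 0 < (s + c).re → mellin f s = Complex.Gamma (s + c) := by
    intro s hs
    rw [Complex.Gamma_eq_integral hs, Complex.GammaIntegral, mellin]
    refine setIntegral_congr_fun measurableSet_Ioi fun x hx => ?_
    have hx : (x : ℂ) ≠ 0 := ofReal_ne_zero.2 (ne_of_gt hx)
    simp only [f, smul_eq_mul]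
    rw [show s + c - 1 = (s - 1) + c by ring, cpow_add _ _ hx]
    push_cast
    ring
  have hconv : MellinConvergent f ((0 : ℝ) : ℂ) := by
    have := Complex.GammaIntegral_convergent hc
    refine this.congr_fun (fun x hx => ?_) measurableSet_Ioi
    have hx : (x : ℂ) ≠ 0 := ofReal_ne_zero.2 (ne_of_gt hx)
    simp only [f, smul_eq_mul]
    rw [show c - 1 = (((0 : ℝ) : ℂ) - 1) + c by push_cast; ring, cpow_add _ _ hx]
    push_cast
    ring
  have hv : VerticalIntegrable (mellin f) 0 := by
    refine (integrable_Gamma_vertical hc).congr (Filter.Eventually.of_forall fun t => ?_)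
    simp only
    rw [hm _ (by simpa using hc)]
    congr 1
    push_cast
    ring
  have hcont : ContinuousAt f x := by
    apply ContinuousAt.mul
    · exact (continuousAt_ofReal_cpow_const _ _ (Or.inr hx.ne'))
    · fun_prop
  have := mellinInv_mellin_eq 0 f hx hconv hv hcont
  rw [mellinInv] at this
  change _ = (x : ℂ) ^ c * Complex.exp (-x) at this
  rw [← this]
  have hpi : (π : ℂ) ≠ 0 := ofReal_ne_zero.2 Real.pi_ne_zero
  rw [Complex.real_smul]
  push_cast
  field_simp
  refine integral_congr_ae (Filter.Eventually.of_forall fun t => ?_)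
  simp only [smul_eq_mul]
  rw [hm _ (by simpa using hc)]
  congr 2 <;> ring

theorem image_sq_Ioo : (fun z : ℝ => z ^ 2) '' Set.Ioo (0 : ℝ) 1 = Set.Ioo 0 1 := by
  ext y
  constructor
  · rintro ⟨z, ⟨h0, h1⟩, rfl⟩
    exact ⟨by positivity, by nlinarith⟩
  · rintro ⟨h0, h1⟩
    refine ⟨√y, ⟨Real.sqrt_pos.2 h0, ?_⟩, Real.sq_sqrt h0.le⟩
    rw [Real.sqrt_lt' one_pos]; simpa using h1

theorem injOn_sq_Ioo : InjOn (fun z : ℝ => z ^ 2) (Ioo 0 1) := fun x hx y hy h => by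
  have := hx.1
  have := hy.1
  exact (pow_left_inj₀ hx.1.le hy.1.le two_ne_zero).1 h

/-- The integrand of the Beta integral after squaring the variable. -/
noncomputable def betaSqIntegrand (p q : ℂ) (z : ℝ) : ℂ :=
  2 * ((1 - z ^ 2 : ℝ) : ℂ) ^ (p - 1) * (z : ℂ) ^ (2 * q - 1)

theorem abs_deriv_smul_betaIntegrand (p q : ℂ) {z : ℝ} (hz : z ∈ Ioo (0 : ℝ) 1) :
    |2 * z| • (((z ^ 2 : ℝ) : ℂ) ^ (q - 1) * (1 - ((z ^ 2 : ℝ) : ℂ)) ^ (p - 1)) =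
      betaSqIntegrand p q z := by
  have h0 : (z : ℂ) ≠ 0 := ofReal_ne_zero.2 hz.1.ne'
  have := hz.1
  rw [abs_of_pos (by positivity), Complex.real_smul, betaSqIntegrand,
    show (2 * q - 1) = 1 + (q - 1) + (q - 1) by ring, cpow_add _ _ h0, cpow_add _ _ h0, cpow_one,
    pow_two, ofReal_mul z z, mul_cpow_ofReal_nonneg hz.1.le hz.1.le]
  push_cast
  ring

theorem hasDerivWithinAt_sq (s : Set ℝ) (z : ℝ) :
    HasDerivWithinAt (fun z : ℝ => z ^ 2) (2 * z) s z := by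
  simpa using (hasDerivAt_pow 2 z).hasDerivWithinAt (s := s)

theorem integrableOn_betaSqIntegrand {p q : ℂ} (hp : 0 < p.re) (hq : 0 < q.re) :
    IntegrableOn (betaSqIntegrand p q) (Ioo 0 1) := by
  have h := betaIntegral_convergent hq hp
  rw [intervalIntegrable_iff_integrableOn_Ioo_of_le zero_le_one, ← image_sq_Ioo,
    integrableOn_image_iff_integrableOn_abs_deriv_smul measurableSet_Ioo
      (fun x _ => hasDerivWithinAt_sq _ x) injOn_sq_Ioo] at h
  exact h.congr_fun (fun z hz => abs_deriv_smul_betaIntegrand p q hz) measurableSet_Ioo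

theorem integral_betaSqIntegrand {p q : ℂ} (hp : 0 < p.re) (hq : 0 < q.re) :
    ∫ z in Ioo 0 1, betaSqIntegrand p q z = cBeta p q := by
  have h := Gamma_mul_Gamma_eq_betaIntegral hq hp
  have hne : Complex.Gamma (p + q) ≠ 0 := Complex.Gamma_ne_zero_of_re_pos (by simp; linarith)
  rw [cBeta, mul_comm, h, add_comm q p, mul_div_cancel_left₀ _ hne, betaIntegral,
    intervalIntegral.integral_of_le zero_le_one, integral_Ioc_eq_integral_Ioo]
  conv_rhs => rw [← image_sq_Ioo]
  rw [integral_image_eq_integral_abs_deriv_smul measurableSet_Ioo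
      (fun x _ => hasDerivWithinAt_sq _ x) injOn_sq_Ioo]
  exact setIntegral_congr_fun measurableSet_Ioo
    fun z hz => (abs_deriv_smul_betaIntegrand p q hz).symm

theorem sqrt_one_sub_sq_pos {z : ℝ} (hz : z ∈ Set.Ioo (0 : ℝ) 1) : 0 < √(1 - z ^ 2) :=
  Real.sqrt_pos.2 (by nlinarith [hz.1, hz.2])

/-- The joint integrand, in the Mellin-Barnes variables `t` and the Beta variable `z`. -/
noncomputable def barnesIntegrand (c₁ c₂ p q : ℂ) (X Y : ℝ) (t : ℝ × ℝ) (z : ℝ) : ℂ :=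
  ((X : ℂ) ^ (-(I * t.1)) * Complex.Gamma (c₁ + I * t.1)) *
    ((Y : ℂ) ^ (-(I * t.2)) * Complex.Gamma (c₂ + I * t.2)) *
      betaSqIntegrand (p + I * t.1 / 2) (q + I * t.2 / 2) z

/-- The result of integrating `barnesIntegrand` over the Mellin-Barnes variables. -/
noncomputable def barnesKernel (c₁ c₂ p q : ℂ) (X Y : ℝ) (z : ℝ) : ℂ :=
  betaSqIntegrand p q z *
    (((X / √(1 - z ^ 2) : ℝ) : ℂ) ^ c₁ * Complex.exp (-(X / √(1 - z ^ 2) : ℝ))) *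
      (((Y / z : ℝ) : ℂ) ^ c₂ * Complex.exp (-(Y / z : ℝ)))

theorem barnesIntegrand_eq (c₁ c₂ p q : ℂ) {X Y : ℝ} (hX : 0 < X) (hY : 0 < Y) (t : ℝ × ℝ)
    {z : ℝ} (hz : z ∈ Set.Ioo (0 : ℝ) 1) :
    barnesIntegrand c₁ c₂ p q X Y t z = betaSqIntegrand p q z *
      ((((X / √(1 - z ^ 2) : ℝ) : ℂ) ^ (-(I * t.1)) * Complex.Gamma (c₁ + I * t.1)) *
        (((Y / z : ℝ) : ℂ) ^ (-(I * t.2)) * Complex.Gamma (c₂ + I * t.2))) := by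
  have hh := sqrt_one_sub_sq_pos hz
  have h1 : 0 < 1 - z ^ 2 := Real.sqrt_pos.1 hh
  have h1' : ((1 - z ^ 2 : ℝ) : ℂ) ≠ 0 := ofReal_ne_zero.2 h1.ne'
  have hz' : (z : ℂ) ≠ 0 := ofReal_ne_zero.2 hz.1.ne'
  have hhC : ((√(1 - z ^ 2) : ℝ) : ℂ) ≠ 0 := ofReal_ne_zero.2 hh.ne'
  have e1 : ((1 - z ^ 2 : ℝ) : ℂ) ^ (I * t.1 / 2) = ((√(1 - z ^ 2) : ℝ) : ℂ) ^ (I * t.1) := by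
    rw [cpow_def_of_ne_zero h1', cpow_def_of_ne_zero hhC, ← ofReal_log h1.le, ← ofReal_log hh.le,
      Real.log_sqrt h1.le]
    congr 1
    push_cast
    ring
  rw [barnesIntegrand, betaSqIntegrand, betaSqIntegrand,
    show p + I * t.1 / 2 - 1 = (p - 1) + I * t.1 / 2 by ring,
    show 2 * (q + I * t.2 / 2) - 1 = (2 * q - 1) + I * t.2 by ring,
    cpow_add _ _ h1', cpow_add _ _ hz', e1, ofReal_div, ofReal_div,
    div_cpow_ofReal_nonneg hX.le hh.le, div_cpow_ofReal_nonneg hY.le hz.1.le]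
  simp only [cpow_neg _ (I * _)]
  field_simp

theorem norm_ofReal_cpow_neg_I_mul {x : ℝ} (hx : 0 < x) (t : ℝ) :
    ‖(x : ℂ) ^ (-(I * t))‖ = 1 := by
  rw [norm_cpow_eq_rpow_re_of_pos hx]; simp

theorem integrable_barnesIntegrand {c₁ c₂ p q : ℂ} (hc₁ : 0 < c₁.re) (hc₂ : 0 < c₂.re)
    (hp : 0 < p.re) (hq : 0 < q.re) {X Y : ℝ} (hX : 0 < X) (hY : 0 < Y) :
    Integrable (Function.uncurry (barnesIntegrand c₁ c₂ p q X Y))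
      ((volume : Measure (ℝ × ℝ)).prod (volume.restrict (Set.Ioo (0 : ℝ) 1))) := by
  have hG := (integrable_Gamma_vertical hc₁).mul_prod (integrable_Gamma_vertical hc₂)
  have hint := (hG.norm).mul_prod (integrableOn_betaSqIntegrand hp hq).norm
  refine hint.mono' ?_ ?_
  · have m1 := (continuous_Gamma_vertical hc₁).measurable
    have m2 := (continuous_Gamma_vertical hc₂).measurable
    have m3 : Measurable fun u : (ℝ × ℝ) × ℝ => Complex.Gamma (c₁ + I * u.1.1) :=
      m1.comp (measurable_fst.comp measurable_fst)
    have m4 : Measurable fun u : (ℝ × ℝ) × ℝ => Complex.Gamma (c₂ + I * u.1.2) :=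
      m2.comp (measurable_snd.comp measurable_fst)
    unfold barnesIntegrand betaSqIntegrand Function.uncurry
    refine Measurable.aestronglyMeasurable ?_
    fun_prop
  · have : (volume : Measure (ℝ × ℝ)).prod (volume.restrict (Set.Ioo (0 : ℝ) 1)) =
        ((volume : Measure (ℝ × ℝ)).prod volume).restrict (Set.univ ×ˢ Set.Ioo (0 : ℝ) 1) := by
      rw [← Measure.prod_restrict, Measure.restrict_univ]
    rw [← Measure.volume_eq_prod, this]
    refine (ae_restrict_iff' (MeasurableSet.univ.prod measurableSet_Ioo)).2
      (Filter.Eventually.of_forall ?_)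
    rintro ⟨t, z⟩ ⟨-, hz⟩
    simp only [Function.uncurry]
    rw [barnesIntegrand_eq _ _ _ _ hX hY t hz]
    simp only [norm_mul, norm_ofReal_cpow_neg_I_mul (div_pos hX (sqrt_one_sub_sq_pos hz)),
      norm_ofReal_cpow_neg_I_mul (div_pos hY hz.1), one_mul]
    exact (mul_comm _ _).le

theorem integral_barnesIntegrand_left {c₁ c₂ p q : ℂ} (hc₁ : 0 < c₁.re) (hc₂ : 0 < c₂.re)
    {X Y : ℝ} (hX : 0 < X) (hY : 0 < Y) {z : ℝ} (hz : z ∈ Set.Ioo (0 : ℝ) 1) :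
    ∫ t : ℝ × ℝ, barnesIntegrand c₁ c₂ p q X Y t z =
      (2 * π) ^ 2 * barnesKernel c₁ c₂ p q X Y z := by
  have h := sqrt_one_sub_sq_pos hz
  simp_rw [barnesIntegrand_eq c₁ c₂ p q hX hY _ hz]
  rw [integral_const_mul, Measure.volume_eq_prod,
    integral_prod_mul (fun t : ℝ => ((X / √(1 - z ^ 2) : ℝ) : ℂ) ^ (-(I * t)) *
      Complex.Gamma (c₁ + I * t)) (fun t : ℝ => ((Y / z : ℝ) : ℂ) ^ (-(I * t)) *
      Complex.Gamma (c₂ + I * t)), integral_cpow_mul_Gamma_vertical hc₁ (div_pos hX h),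
    integral_cpow_mul_Gamma_vertical hc₂ (div_pos hY hz.1), barnesKernel]
  ring

theorem integrableOn_barnesKernel {c₁ c₂ p q : ℂ} (hc₁ : 0 < c₁.re) (hc₂ : 0 < c₂.re)
    (hp : 0 < p.re) (hq : 0 < q.re) {X Y : ℝ} (hX : 0 < X) (hY : 0 < Y) :
    IntegrableOn (barnesKernel c₁ c₂ p q X Y) (Set.Ioo 0 1) := by
  have h := ((integrable_barnesIntegrand hc₁ hc₂ hp hq hX hY).integral_prod_right).const_mul
    ((2 * (π : ℂ)) ^ 2)⁻¹
  refine IntegrableOn.congr_fun (s := Set.Ioo 0 1) h (fun z hz => ?_) measurableSet_Ioo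
  have hpi : (2 * (π : ℂ)) ^ 2 ≠ 0 := by simp [Real.pi_ne_zero]
  simp only [Function.uncurry]
  rw [integral_barnesIntegrand_left hc₁ hc₂ hX hY hz, inv_mul_cancel_left₀ hpi]

theorem integral_Gamma_mul_cBeta {c₁ c₂ p q : ℂ} (hc₁ : 0 < c₁.re) (hc₂ : 0 < c₂.re)
    (hp : 0 < p.re) (hq : 0 < q.re) {X Y : ℝ} (hX : 0 < X) (hY : 0 < Y) :
    ∫ t : ℝ × ℝ, ((X : ℂ) ^ (-(I * t.1)) * Complex.Gamma (c₁ + I * t.1)) *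
      ((Y : ℂ) ^ (-(I * t.2)) * Complex.Gamma (c₂ + I * t.2)) *
        cBeta (p + I * t.1 / 2) (q + I * t.2 / 2) =
      (2 * π) ^ 2 * ∫ z in Set.Ioo 0 1, barnesKernel c₁ c₂ p q X Y z := by
  rw [← integral_const_mul, ← setIntegral_congr_fun measurableSet_Ioo
      (fun z hz => integral_barnesIntegrand_left hc₁ hc₂ hX hY hz),
    ← integral_integral_swap (integrable_barnesIntegrand hc₁ hc₂ hp hq hX hY)]
  refine integral_congr_ae (Filter.Eventually.of_forall fun t => ?_)
  simp only [barnesIntegrand]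
  rw [integral_const_mul, integral_betaSqIntegrand (by simpa using hp) (by simpa using hq)]

/-- The kernel of the real integral representation of the Whittaker functions, with the dependence
on `m'` removed. -/
noncomputable def whittakerKernel (d : ℕ) (r : ℂ) (X Y z : ℝ) : ℂ :=
  2 * ((√(1 - z ^ 2) : ℝ) : ℂ) ^ (((d : ℂ) - 1) / 2 - 1 + 3 * r) *
    (z : ℂ) ^ (-((d : ℂ) - 1) / 2 - 1 - 3 * r) *
      (X : ℂ) ^ (((d : ℂ) - 1) / 2 + 1 - r) * (Y : ℂ) ^ (((d : ℂ) - 1) / 2 + 1 + r) *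
        (Complex.exp (-(X / √(1 - z ^ 2) : ℝ)) * Complex.exp (-(Y / z : ℝ)))

/-- The cotangent of half the angle whose cosine is `z`. -/
noncomputable def halfCot (z : ℝ) : ℝ := (1 + z) / √(1 - z ^ 2)

theorem barnesKernel_eq (d m ℓ : ℕ) (r : ℂ) {X Y : ℝ} (hX : 0 < X) (hY : 0 < Y)
    {z : ℝ} (hz : z ∈ Set.Ioo (0 : ℝ) 1) :
    barnesKernel (((d : ℂ) - 1) / 2 + 1 - r) (((d : ℂ) - 1) / 2 + 1 + r)
      (((d : ℂ) - m + 1 + 2 * r) / 2) (((ℓ : ℂ) + 1 - 2 * r) / 2) X Y z =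
      (z : ℂ) ^ ℓ * (((√(1 - z ^ 2) : ℝ) : ℂ) ^ m)⁻¹ * whittakerKernel d r X Y z := by
  have hh := sqrt_one_sub_sq_pos hz
  have h1 : 0 < 1 - z ^ 2 := Real.sqrt_pos.1 hh
  have h1' : ((1 - z ^ 2 : ℝ) : ℂ) ≠ 0 := ofReal_ne_zero.2 h1.ne'
  have hz' : (z : ℂ) ≠ 0 := ofReal_ne_zero.2 hz.1.ne'
  have hhC : ((√(1 - z ^ 2) : ℝ) : ℂ) ≠ 0 := ofReal_ne_zero.2 hh.ne'
  have e1 : ∀ s : ℂ, ((1 - z ^ 2 : ℝ) : ℂ) ^ s = ((√(1 - z ^ 2) : ℝ) : ℂ) ^ (2 * s) := by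
    intro s
    rw [cpow_def_of_ne_zero h1', cpow_def_of_ne_zero hhC, ← ofReal_log h1.le, ← ofReal_log hh.le,
      Real.log_sqrt h1.le]
    congr 1
    push_cast
    ring
  rw [barnesKernel, betaSqIntegrand, whittakerKernel, e1, ofReal_div X, ofReal_div Y,
    div_cpow_ofReal_nonneg hX.le hh.le, div_cpow_ofReal_nonneg hY.le hz.1.le,
    ← cpow_natCast, ← cpow_natCast, ← cpow_neg]
  generalize ((√(1 - z ^ 2) : ℝ) : ℂ) = h at *
  have eh : h ^ (((d : ℂ) - 1) / 2 - 1 + 3 * r) =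
      h ^ (2 * (((d : ℂ) - m + 1 + 2 * r) / 2 - 1)) / h ^ (((d : ℂ) - 1) / 2 + 1 - r) *
        h ^ (m : ℂ) := by
    rw [← cpow_sub _ _ hhC, ← cpow_add _ _ hhC]
    congr 1
    ring
  have ez : (z : ℂ) ^ (-((d : ℂ) - 1) / 2 - 1 - 3 * r) =
      (z : ℂ) ^ (2 * (((ℓ : ℂ) + 1 - 2 * r) / 2) - 1) / (z : ℂ) ^ (((d : ℂ) - 1) / 2 + 1 + r) /
        (z : ℂ) ^ (ℓ : ℂ) := by
    rw [← cpow_sub _ _ hz', ← cpow_sub _ _ hz']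
    congr 1
    ring
  rw [eh, ez, cpow_neg]
  have n1 : h ^ (m : ℂ) ≠ 0 := by simp [hhC]
  have n2 : (z : ℂ) ^ (ℓ : ℂ) ≠ 0 := by simp [hz.1.ne']
  field_simp

theorem halfCot_pos {z : ℝ} (hz : z ∈ Set.Ioo (0 : ℝ) 1) : 0 < halfCot z :=
  div_pos (by linarith [hz.1]) (sqrt_one_sub_sq_pos hz)

theorem halfCot_zpow {z : ℝ} (hz : z ∈ Set.Ioo (0 : ℝ) 1) (m' : ℤ) :
    ((halfCot z : ℝ) : ℂ) ^ m' = (1 + (if 0 ≤ m' then (1 : ℂ) else -1) * z) ^ m'.natAbs *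
      (((√(1 - z ^ 2) : ℝ) : ℂ) ^ m'.natAbs)⁻¹ := by
  have hh := sqrt_one_sub_sq_pos hz
  have h1 : 0 < 1 - z ^ 2 := Real.sqrt_pos.1 hh
  have hz1 : 1 - z ≠ 0 := by linarith [hz.2]
  have hz2 : 1 + z ≠ 0 := by linarith [hz.1]
  rw [← div_eq_mul_inv, ← div_pow]
  split_ifs with h
  · obtain ⟨n, rfl⟩ := Int.eq_ofNat_of_zero_le h
    simp [halfCot]
  · obtain ⟨n, rfl⟩ : ∃ n : ℕ, m' = -n := ⟨m'.natAbs, by omega⟩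
    have : (halfCot z)⁻¹ = (1 - z) / √(1 - z ^ 2) := by
      rw [halfCot, inv_div, div_eq_div_iff hz2 hh.ne', Real.mul_self_sqrt h1.le]
      ring
    rw [zpow_neg, zpow_natCast, Int.natAbs_neg, Int.natAbs_natCast, ← inv_pow, ← ofReal_inv, this]
    push_cast
    congr 2
    ring

theorem sum_barnesKernel (d : ℕ) (m' : ℤ) (r : ℂ) {X Y : ℝ} (hX : 0 < X) (hY : 0 < Y)
    {z : ℝ} (hz : z ∈ Set.Ioo (0 : ℝ) 1) :
    ∑ ℓ ∈ Finset.range (m'.natAbs + 1),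
      (if 0 ≤ m' then (1 : ℂ) else -1) ^ ℓ * ((m'.natAbs).choose ℓ : ℂ) *
        barnesKernel (((d : ℂ) - 1) / 2 + 1 - r) (((d : ℂ) - 1) / 2 + 1 + r)
          (((d : ℂ) - m'.natAbs + 1 + 2 * r) / 2) (((ℓ : ℂ) + 1 - 2 * r) / 2) X Y z =
      ((halfCot z : ℝ) : ℂ) ^ m' * whittakerKernel d r X Y z := by
  rw [halfCot_zpow hz, add_comm (1 : ℂ), add_pow, Finset.sum_mul, Finset.sum_mul]
  refine Finset.sum_congr rfl fun ℓ _ => ?_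
  rw [barnesKernel_eq d m'.natAbs ℓ r hX hY hz]
  simp only [one_pow, mul_pow]
  ring

section

variable {d : ℕ} {r : ℂ} {y₁ y₂ : ℝ} {m' : ℤ}

theorem integrableOn_barnesKernel_whittaker (hd : 1 ≤ d) (hr : r.re = 0) {X Y : ℝ} (hX : 0 < X)
    (hY : 0 < Y) (hm : m'.natAbs ≤ d) (ℓ : ℕ) :
    IntegrableOn (barnesKernel (((d : ℂ) - 1) / 2 + 1 - r) (((d : ℂ) - 1) / 2 + 1 + r)
          (((d : ℂ) - m'.natAbs + 1 + 2 * r) / 2) (((ℓ : ℂ) + 1 - 2 * r) / 2) X Y)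
      (Set.Ioo 0 1) := by
  have hd' : (1 : ℝ) ≤ d := by exact_mod_cast hd
  have hm' : (m'.natAbs : ℝ) ≤ d := by exact_mod_cast hm
  apply integrableOn_barnesKernel _ _ _ _ hX hY
  · simp [hr]; linarith
  · simp [hr]; linarith
  · simp [hr, -Nat.cast_natAbs]; linarith
  · simp [hr]; positivity

theorem integrableOn_halfCot_zpow_mul_whittakerKernel (hd : 1 ≤ d) (hr : r.re = 0) {X Y : ℝ}
    (hX : 0 < X) (hY : 0 < Y) (hm : m'.natAbs ≤ d) :
    IntegrableOn (fun z => ((halfCot z : ℝ) : ℂ) ^ m' * whittakerKernel d r X Y z)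
      (Set.Ioo 0 1) := by
  refine IntegrableOn.congr_fun (f := fun z => _) ?_
    (fun z hz => sum_barnesKernel d m' r hX hY hz) measurableSet_Ioo
  refine integrable_finsetSum _ fun ℓ _ => ?_
  exact (integrableOn_barnesKernel_whittaker hd hr hX hY hm ℓ).const_mul _

theorem Wstar_eq (hd : 1 ≤ d) (hr : r.re = 0) (hy₁ : 0 < y₁) (hy₂ : 0 < y₂)
    (hm : m'.natAbs ≤ d) :
    Wstar d r y₁ y₂ m' = ((2 : ℂ) ^ (d + 1) * (Real.pi : ℂ))⁻¹ *
      (Real.sqrt ((2 * d).choose (d + m'.natAbs)) : ℂ) *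
      ∫ z in Set.Ioo 0 1, ((halfCot z : ℝ) : ℂ) ^ m' *
        whittakerKernel d r (2 * π * y₁) (2 * π * y₂) z := by
  have hX : 0 < 2 * π * y₁ := by positivity
  have hY : 0 < 2 * π * y₂ := by positivity
  have hd' : (1 : ℝ) ≤ d := by exact_mod_cast hd
  have hm' : (m'.natAbs : ℝ) ≤ d := by exact_mod_cast hm
  rw [Wstar, ← setIntegral_congr_fun measurableSet_Ioo
    (fun z hz => sum_barnesKernel d m' r hX hY hz), integral_finsetSum _ fun ℓ _ =>
      (integrableOn_barnesKernel_whittaker hd hr hX hY hm ℓ).const_mul _]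
  congr 1
  refine Finset.sum_congr rfl fun ℓ _ => ?_
  have key := integral_Gamma_mul_cBeta (c₁ := ((d : ℂ) - 1) / 2 + 1 - r)
    (c₂ := ((d : ℂ) - 1) / 2 + 1 + r) (p := ((d : ℂ) - m'.natAbs + 1 + 2 * r) / 2)
    (q := ((ℓ : ℂ) + 1 - 2 * r) / 2) (by simp [hr]; linarith) (by simp [hr]; linarith)
    (by simp [hr, -Nat.cast_natAbs]; linarith) (by simp [hr]; positivity) hX hY
  rw [integral_const_mul, mul_assoc _ ((((2 * π : ℝ) : ℂ))⁻¹ ^ 2)]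
  congr 1
  have hpi : (2 * (π : ℂ)) ^ 2 ≠ 0 := by simp [Real.pi_ne_zero]
  rw [inv_pow, ofReal_mul, ofReal_ofNat, inv_mul_eq_iff_eq_mul₀ hpi, ← key]
  refine integral_congr_ae (Filter.Eventually.of_forall fun t => ?_)
  simp only
  rw [show (1 : ℂ) - (1 + I * t.1) = -(I * t.1) by ring,
    show (1 : ℂ) - (1 + I * t.2) = -(I * t.2) by ring,
    show ((d : ℂ) - 1) / 2 + (1 + I * t.1) - r = ((d : ℂ) - 1) / 2 + 1 - r + I * t.1 by ring,
    show ((d : ℂ) - 1) / 2 + (1 + I * t.2) + r = ((d : ℂ) - 1) / 2 + 1 + r + I * t.2 by ring,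
    show ((d : ℂ) - m'.natAbs + (1 + I * t.1) + 2 * r) / 2 =
      ((d : ℂ) - m'.natAbs + 1 + 2 * r) / 2 + I * t.1 / 2 by ring,
    show ((ℓ : ℂ) + (1 + I * t.2) - 2 * r) / 2 = ((ℓ : ℂ) + 1 - 2 * r) / 2 + I * t.2 / 2 by ring]
  ring

end

theorem sum_choose_mul_zpow (d : ℕ) {C : ℂ} (hC : C ≠ 0) :
    ∑ m' ∈ Finset.Icc (-(d : ℤ)) d, ((2 * d).choose (d + m'.natAbs) : ℂ) * C ^ m' =
      ((1 + C) ^ 2 / C) ^ d := by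
  have h : ∑ m' ∈ Finset.Icc (-(d : ℤ)) d, ((2 * d).choose (d + m'.natAbs) : ℂ) * C ^ m' =
      ∑ k ∈ Finset.range (2 * d + 1), ((2 * d).choose k : ℂ) * C ^ ((k : ℤ) - d) := by
    symm
    refine Finset.sum_bij (fun k _ => (k : ℤ) - d) ?_ ?_ ?_ ?_
    · intro k hk
      simp only [Finset.mem_range, Finset.mem_Icc] at *
      omega
    · intro a _ b _ hab
      omega
    · intro b hb
      simp only [Finset.mem_range, Finset.mem_Icc] at *
      exact ⟨(b + d).toNat, by omega, by omega⟩
    · intro k hk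
      simp only [Finset.mem_range] at hk
      congr 2
      rcases le_total d k with h | h
      · congr 1
        omega
      · rw [← Nat.choose_symm (by omega)]
        congr 1
        omega
  rw [h, div_pow, ← pow_mul, add_comm (1 : ℂ), add_pow, Finset.sum_div]
  refine Finset.sum_congr rfl fun k hk => ?_
  rw [zpow_sub₀ hC, zpow_natCast, zpow_natCast, one_pow]
  ring

/-- The sum of products of Whittaker functions as a double integral. -/
theorem sum_Wstar_mul_Wstar {d : ℕ} (hd : 1 ≤ d) {r r' : ℂ} (hr : r.re = 0) (hr' : r'.re = 0)
    {y₁ y₂ : ℝ} (hy₁ : 0 < y₁) (hy₂ : 0 < y₂) :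
    ∑ m' ∈ Finset.Icc (-(d : ℤ)) (d : ℤ), Wstar d r y₁ y₂ m' * Wstar d r' y₁ y₂ m' =
      ((2 : ℂ) ^ (d + 1) * (Real.pi : ℂ))⁻¹ ^ 2 *
      ∫ z in Set.Ioo (0 : ℝ) 1 ×ˢ Set.Ioo (0 : ℝ) 1,
        ((1 + (halfCot z.1 * halfCot z.2 : ℝ)) ^ 2 / (halfCot z.1 * halfCot z.2 : ℝ) : ℂ) ^ d *
        (whittakerKernel d r (2 * π * y₁) (2 * π * y₂) z.1 *
          whittakerKernel d r' (2 * π * y₁) (2 * π * y₂) z.2) := by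
  have hX : 0 < 2 * π * y₁ := by positivity
  have hY : 0 < 2 * π * y₂ := by positivity
  have hmem : ∀ m' ∈ Finset.Icc (-(d : ℤ)) (d : ℤ), m'.natAbs ≤ d := by
    intro m' hm
    simp only [Finset.mem_Icc] at hm
    omega
  have hprod : ∀ m' ∈ Finset.Icc (-(d : ℤ)) (d : ℤ),
      IntegrableOn (fun z : ℝ × ℝ => ((2 * d).choose (d + m'.natAbs) : ℂ) *
        ((((halfCot z.1 : ℝ) : ℂ) ^ m' * whittakerKernel d r (2 * π * y₁) (2 * π * y₂) z.1) *
        (((halfCot z.2 : ℝ) : ℂ) ^ m' * whittakerKernel d r' (2 * π * y₁) (2 * π * y₂) z.2)))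
        (Set.Ioo (0 : ℝ) 1 ×ˢ Set.Ioo (0 : ℝ) 1) := by
    intro m' hm
    rw [IntegrableOn, Measure.volume_eq_prod, ← Measure.prod_restrict]
    exact ((integrableOn_halfCot_zpow_mul_whittakerKernel hd hr hX hY (hmem m' hm)).mul_prod
      (integrableOn_halfCot_zpow_mul_whittakerKernel hd hr' hX hY (hmem m' hm))).const_mul _
  have hpt : ∀ z ∈ Set.Ioo (0 : ℝ) 1 ×ˢ Set.Ioo (0 : ℝ) 1,
      ((1 + (halfCot z.1 * halfCot z.2 : ℝ)) ^ 2 / (halfCot z.1 * halfCot z.2 : ℝ) : ℂ) ^ d *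
        (whittakerKernel d r (2 * π * y₁) (2 * π * y₂) z.1 *
          whittakerKernel d r' (2 * π * y₁) (2 * π * y₂) z.2) =
      ∑ m' ∈ Finset.Icc (-(d : ℤ)) (d : ℤ), ((2 * d).choose (d + m'.natAbs) : ℂ) *
        ((((halfCot z.1 : ℝ) : ℂ) ^ m' * whittakerKernel d r (2 * π * y₁) (2 * π * y₂) z.1) *
        (((halfCot z.2 : ℝ) : ℂ) ^ m' * whittakerKernel d r' (2 * π * y₁) (2 * π * y₂) z.2)) := by
    rintro z ⟨h1, h2⟩
    rw [← sum_choose_mul_zpow d (ofReal_ne_zero.2 (mul_pos (halfCot_pos h1) (halfCot_pos h2)).ne'),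
      Finset.sum_mul]
    refine Finset.sum_congr rfl fun m' _ => ?_
    rw [ofReal_mul, mul_zpow]
    ring
  rw [setIntegral_congr_fun (measurableSet_Ioo.prod measurableSet_Ioo) hpt,
    integral_finsetSum _ hprod, Finset.mul_sum]
  refine Finset.sum_congr rfl fun m' hm => ?_
  rw [integral_const_mul, Measure.volume_eq_prod,
    setIntegral_prod_mul
      (fun z => ((halfCot z : ℝ) : ℂ) ^ m' * whittakerKernel d r (2 * π * y₁) (2 * π * y₂) z)
      (fun z => ((halfCot z : ℝ) : ℂ) ^ m' * whittakerKernel d r' (2 * π * y₁) (2 * π * y₂) z),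
    Wstar_eq hd hr hy₁ hy₂ (hmem m' hm), Wstar_eq hd hr' hy₁ hy₂ (hmem m' hm)]
  have hsq : ((√((2 * d).choose (d + m'.natAbs)) : ℝ) : ℂ) ^ 2 =
      ((2 * d).choose (d + m'.natAbs) : ℂ) := by
    rw [← ofReal_pow, Real.sq_sqrt (by positivity), ofReal_natCast]
  rw [← hsq]
  ring

/-- The change of variables that factorises the angular integral. -/
noncomputable def stadeMap (p : ℝ × ℝ) : ℝ × ℝ :=
  (2 * p.1 * p.2 / (1 + p.1 ^ 2 * (2 * p.2 - 1)),
    2 * p.1 * (1 - p.2) / (1 - p.1 ^ 2 * (2 * p.2 - 1)))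

/-- The derivative of `stadeMap`. -/
noncomputable def fderivStadeMap (p : ℝ × ℝ) : ℝ × ℝ →L[ℝ] ℝ × ℝ :=
  LinearMap.toContinuousLinearMap (Matrix.toLin (Module.Basis.finTwoProd ℝ)
    (Module.Basis.finTwoProd ℝ)
    !![2 * p.2 * (1 - p.1 ^ 2 * (2 * p.2 - 1)) / (1 + p.1 ^ 2 * (2 * p.2 - 1)) ^ 2,
      2 * p.1 * (1 - p.1 ^ 2) / (1 + p.1 ^ 2 * (2 * p.2 - 1)) ^ 2;
      2 * (1 - p.2) * (1 + p.1 ^ 2 * (2 * p.2 - 1)) / (1 - p.1 ^ 2 * (2 * p.2 - 1)) ^ 2,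
      -(2 * p.1 * (1 - p.1 ^ 2) / (1 - p.1 ^ 2 * (2 * p.2 - 1)) ^ 2)])

theorem stadeMap_den_pos {s l : ℝ} (hs : s ∈ Set.Ioo (0 : ℝ) 1)
    (hl : l ∈ Set.Ioo (0 : ℝ) 1) :
    0 < 1 + s ^ 2 * (2 * l - 1) ∧ 0 < 1 - s ^ 2 * (2 * l - 1) := by
  obtain ⟨h1, h2⟩ := hs
  obtain ⟨h3, h4⟩ := hl
  have h5 : s ^ 2 < 1 := by nlinarith
  have h6 : 0 < s ^ 2 := by positivity
  constructor <;> nlinarith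

theorem one_sub_sq_mul_pos {s l : ℝ} (hs : s ∈ Set.Ioo (0 : ℝ) 1)
    (hl : l ∈ Set.Ioo (0 : ℝ) 1) :
    0 < 1 - s ^ 2 * (2 * l - 1) ^ 2 := by
  obtain ⟨h1, h2⟩ := hs
  obtain ⟨h3, h4⟩ := hl
  have h5 : s ^ 2 < 1 := by nlinarith
  have h6 : 0 < s ^ 2 := by positivity
  have h7 : (2 * l - 1) ^ 2 < 1 := by nlinarith
  nlinarith

theorem hasFDerivAt_stadeMap {s l : ℝ} (hs : s ∈ Set.Ioo (0 : ℝ) 1)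
    (hl : l ∈ Set.Ioo (0 : ℝ) 1) :
    HasFDerivAt stadeMap (fderivStadeMap (s, l)) (s, l) := by
  obtain ⟨h1, h2⟩ := stadeMap_den_pos hs hl
  rw [fderivStadeMap, Matrix.toLin_finTwoProd_toContinuousLinearMap]
  have ds : HasFDerivAt (fun p : ℝ × ℝ => p.1) (ContinuousLinearMap.fst ℝ ℝ ℝ) (s, l) :=
    hasFDerivAt_fst
  have dl : HasFDerivAt (fun p : ℝ × ℝ => p.2) (ContinuousLinearMap.snd ℝ ℝ ℝ) (s, l) :=
    hasFDerivAt_snd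
  have dq := (ds.pow 2).mul ((dl.const_mul 2).sub_const 1)
  have d1 := ((ds.const_mul 2).mul dl).mul ((hasDerivAt_inv h1.ne').comp_hasFDerivAt (s, l)
    (dq.const_add 1))
  have d2 := ((ds.const_mul 2).mul (dl.const_sub 1)).mul
    ((hasDerivAt_inv h2.ne').comp_hasFDerivAt (s, l) (dq.const_sub 1))
  convert! d1.prodMk d2 using 1
  ext <;> simp <;> field_simp <;> ring

theorem abs_det_fderivStadeMap {s l : ℝ} (hs : s ∈ Set.Ioo (0 : ℝ) 1)
    (hl : l ∈ Set.Ioo (0 : ℝ) 1) :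
    |(fderivStadeMap (s, l)).det| =
    4 * s * (1 - s ^ 2) * (1 - s ^ 2 * (2 * l - 1) ^ 2) /
      ((1 + s ^ 2 * (2 * l - 1)) ^ 2 * (1 - s ^ 2 * (2 * l - 1)) ^ 2) := by
  obtain ⟨h1, h2⟩ := stadeMap_den_pos hs hl
  have h3 := one_sub_sq_mul_pos hs hl
  have h4 : 0 < 1 - s ^ 2 := by nlinarith [hs.1, hs.2]
  have h5 := hs.1
  have : (fderivStadeMap (s, l)).det =
      -(4 * s * (1 - s ^ 2) * (1 - s ^ 2 * (2 * l - 1) ^ 2) /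
      ((1 + s ^ 2 * (2 * l - 1)) ^ 2 * (1 - s ^ 2 * (2 * l - 1)) ^ 2)) := by
    rw [fderivStadeMap, LinearMap.det_toContinuousLinearMap, LinearMap.det_toLin,
      Matrix.det_fin_two_of]
    field_simp
    ring
  rw [this, abs_neg, abs_of_pos (by positivity)]

theorem stadeMap_mem {s l : ℝ} (hs : s ∈ Set.Ioo (0 : ℝ) 1)
    (hl : l ∈ Set.Ioo (0 : ℝ) 1) :
    stadeMap (s, l) ∈ Set.Ioo (0 : ℝ) 1 ×ˢ Set.Ioo (0 : ℝ) 1 := by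
  obtain ⟨h1, h2⟩ := stadeMap_den_pos hs hl
  obtain ⟨h3, h4⟩ := hs
  obtain ⟨h5, h6⟩ := hl
  have h7 : 0 < 1 - l := by linarith
  refine ⟨⟨?_, ?_⟩, ?_, ?_⟩
  · simp only [stadeMap]; positivity
  · simp only [stadeMap]
    rw [div_lt_one h1]
    nlinarith [mul_pos h7 (sub_pos.2 h4), mul_pos h3 h7, mul_pos (mul_pos h3 h7) (sub_pos.2 h4)]
  · simp only [stadeMap]; positivity
  · simp only [stadeMap]
    rw [div_lt_one h2]
    nlinarith [mul_pos h5 (sub_pos.2 h4), mul_pos h3 h5, mul_pos (mul_pos h3 h5) (sub_pos.2 h4)]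

theorem two_mul_div_injOn {s s' : ℝ} (hs : s ∈ Set.Ioo (0 : ℝ) 1) (hs' : s' ∈ Set.Ioo (0 : ℝ) 1)
    (h : 2 * s / (1 + s ^ 2) = 2 * s' / (1 + s' ^ 2)) : s = s' := by
  rw [div_eq_div_iff (by positivity) (by positivity)] at h
  have h1 : (s - s') * (1 - s * s') = 0 := by linarith
  rcases mul_eq_zero.1 h1 with h1 | h1
  · linarith
  · nlinarith [hs.1, hs.2, hs'.1, hs'.2]

theorem stadeMap_add_div {s l : ℝ} (hs : s ∈ Set.Ioo (0 : ℝ) 1) (hl : l ∈ Set.Ioo (0 : ℝ) 1) :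
    ((stadeMap (s, l)).1 + (stadeMap (s, l)).2) /
      (1 + (stadeMap (s, l)).1 * (stadeMap (s, l)).2) = 2 * s / (1 + s ^ 2) := by
  obtain ⟨h1, h2⟩ := stadeMap_den_pos hs hl
  obtain ⟨⟨h3, -⟩, h4, -⟩ := stadeMap_mem hs hl
  rw [div_eq_div_iff (by positivity) (by positivity)]
  simp only [stadeMap]
  field_simp
  ring

theorem injOn_stadeMap : InjOn stadeMap (Set.Ioo (0 : ℝ) 1 ×ˢ Set.Ioo (0 : ℝ) 1) := by
  rintro ⟨s, l⟩ ⟨hs, hl⟩ ⟨s', l'⟩ ⟨hs', hl'⟩ h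
  simp only at hs hl hs' hl'
  obtain rfl : s = s' := by
    apply two_mul_div_injOn hs hs'
    rw [← stadeMap_add_div hs hl, ← stadeMap_add_div hs' hl', h]
  have h1 := (stadeMap_den_pos hs hl).1
  have h1' := (stadeMap_den_pos hs hl').1
  have h3 := congrArg Prod.fst h
  simp only [stadeMap] at h3
  rw [div_eq_div_iff h1.ne' h1'.ne'] at h3
  have h4 : 2 * s * (1 - s ^ 2) * (l - l') = 0 := by linarith
  have h5 : 2 * s * (1 - s ^ 2) ≠ 0 := by
    have := hs.1
    have : 0 < 1 - s ^ 2 := by nlinarith [hs.1, hs.2]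
    positivity
  have := (mul_eq_zero.1 h4).resolve_left h5
  rw [sub_eq_zero.1 this]

theorem exists_two_mul_div {z : ℝ} (hz : z ∈ Set.Ioo (0 : ℝ) 1) :
    ∃ x ∈ Set.Ioo (0 : ℝ) 1, z = 2 * x / (1 + x ^ 2) := by
  have hh := sqrt_one_sub_sq_pos hz
  have hsq := Real.sq_sqrt (Real.sqrt_pos.1 hh).le
  obtain ⟨h0, h1⟩ := hz
  refine ⟨z / (1 + √(1 - z ^ 2)), ⟨by positivity, ?_⟩, ?_⟩
  · rw [div_lt_one (by positivity)]; linarith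
  · generalize √(1 - z ^ 2) = h at *
    field_simp
    nlinarith

theorem image_stadeMap : stadeMap '' (Set.Ioo (0 : ℝ) 1 ×ˢ Set.Ioo (0 : ℝ) 1) =
    Set.Ioo (0 : ℝ) 1 ×ˢ Set.Ioo (0 : ℝ) 1 := by
  refine Set.Subset.antisymm ?_ ?_
  · rintro _ ⟨⟨s, l⟩, ⟨hs, hl⟩, rfl⟩
    exact stadeMap_mem hs hl
  · rintro ⟨z₁, z₂⟩ ⟨h₁, h₂⟩
    obtain ⟨x, hx, rfl⟩ := exists_two_mul_div h₁
    obtain ⟨y, hy, rfl⟩ := exists_two_mul_div h₂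
    obtain ⟨hx0, hx1⟩ := hx
    obtain ⟨hy0, hy1⟩ := hy
    have hxy : 0 < 1 - x * y := by nlinarith
    have hxx : 0 < 1 - x ^ 2 := by nlinarith
    have hyy : 0 < 1 - y ^ 2 := by nlinarith
    have hS : (x + y) / (1 + x * y) ∈ Set.Ioo (0 : ℝ) 1 := by
      refine ⟨by positivity, ?_⟩
      rw [div_lt_one (by positivity)]; nlinarith
    have hL : x * (1 - y ^ 2) / ((x + y) * (1 - x * y)) ∈ Set.Ioo (0 : ℝ) 1 := by
      refine ⟨by positivity, ?_⟩
      rw [div_lt_one (by positivity)]; nlinarith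
    refine ⟨(_, _), ⟨hS, hL⟩, ?_⟩
    obtain ⟨h1, h2⟩ := stadeMap_den_pos hS hL
    have e1 : 1 + ((x + y) / (1 + x * y)) ^ 2 *
        (2 * (x * (1 - y ^ 2) / ((x + y) * (1 - x * y))) - 1) =
          (1 + x ^ 2) * (1 - y ^ 2) / ((1 + x * y) * (1 - x * y)) := by
      field_simp
      ring
    have e2 : 1 - ((x + y) / (1 + x * y)) ^ 2 *
        (2 * (x * (1 - y ^ 2) / ((x + y) * (1 - x * y))) - 1) =
          (1 + y ^ 2) * (1 - x ^ 2) / ((1 + x * y) * (1 - x * y)) := by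
      field_simp
      ring
    simp only [stadeMap, e1, e2, Prod.mk.injEq]
    constructor
    · field_simp
    · field_simp
      ring

theorem ofReal_cpow_eq_exp {x : ℝ} (hx : 0 < x) (c : ℂ) :
    (x : ℂ) ^ c = Complex.exp (Real.log x * c) := by
  rw [cpow_def_of_ne_zero (ofReal_ne_zero.2 hx.ne'), ← ofReal_log hx.le]

/-- The factor of the zeta integrand depending only on the variables `z` of the kernels. -/
noncomputable def angularWeight (d : ℕ) (r r' : ℂ) (z : ℝ × ℝ) : ℂ :=
  (((1 + halfCot z.1 * halfCot z.2) ^ 2 / (halfCot z.1 * halfCot z.2) : ℝ) : ℂ) ^ d * 4 *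
    ((√(1 - z.1 ^ 2) : ℝ) : ℂ) ^ (((d : ℂ) - 1) / 2 - 1 + 3 * r) *
    (z.1 : ℂ) ^ (-((d : ℂ) - 1) / 2 - 1 - 3 * r) *
    ((√(1 - z.2 ^ 2) : ℝ) : ℂ) ^ (((d : ℂ) - 1) / 2 - 1 + 3 * r') *
    (z.2 : ℂ) ^ (-((d : ℂ) - 1) / 2 - 1 - 3 * r')

theorem ofReal_eq_exp_log {x : ℝ} (hx : 0 < x) : (x : ℂ) = Complex.exp (Real.log x) := by
  rw [← ofReal_exp, Real.exp_log hx]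

/-- What remains of the zeta integrand after integrating over `y₁` and `y₂`, up to Gamma factors. -/
noncomputable def angularIntegrand (d : ℕ) (r r' t : ℂ) (z : ℝ × ℝ) : ℂ :=
  angularWeight d r r' z *
    ((1 / √(1 - z.1 ^ 2) + 1 / √(1 - z.2 ^ 2) : ℝ) : ℂ) ^ (-(2 * t + (d - 1) - r - r')) *
    ((1 / z.1 + 1 / z.2 : ℝ) : ℂ) ^ (-(t + (d - 1) + r + r'))

theorem sqrt_one_sub_stadeMap {s l : ℝ} (hs : s ∈ Set.Ioo (0 : ℝ) 1)
    (hl : l ∈ Set.Ioo (0 : ℝ) 1) :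
    √(1 - (stadeMap (s, l)).1 ^ 2) =
        √((1 - s ^ 2) * (1 - s ^ 2 * (2 * l - 1) ^ 2)) / (1 + s ^ 2 * (2 * l - 1)) ∧
      √(1 - (stadeMap (s, l)).2 ^ 2) =
        √((1 - s ^ 2) * (1 - s ^ 2 * (2 * l - 1) ^ 2)) / (1 - s ^ 2 * (2 * l - 1)) := by
  obtain ⟨h1, h2⟩ := stadeMap_den_pos hs hl
  have h3 := one_sub_sq_mul_pos hs hl
  have h4 : 0 < 1 - s ^ 2 := by nlinarith [hs.1, hs.2]
  constructor
  · rw [Real.sqrt_eq_iff_mul_self_eq_of_pos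
      (div_pos (Real.sqrt_pos.2 (mul_pos h4 h3)) h1), div_mul_div_comm,
      Real.mul_self_sqrt (mul_pos h4 h3).le]
    simp only [stadeMap]
    field_simp
    ring
  · rw [Real.sqrt_eq_iff_mul_self_eq_of_pos
      (div_pos (Real.sqrt_pos.2 (mul_pos h4 h3)) h2), div_mul_div_comm,
      Real.mul_self_sqrt (mul_pos h4 h3).le]
    simp only [stadeMap]
    field_simp
    ring

theorem abs_det_smul_angularIntegrand (d : ℕ) (r r' t : ℂ) {s l : ℝ}
    (hs : s ∈ Set.Ioo (0 : ℝ) 1) (hl : l ∈ Set.Ioo (0 : ℝ) 1) :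
    |(fderivStadeMap (s, l)).det| • angularIntegrand d r r' t (stadeMap (s, l)) =
      4 ^ d * 2 * (2 : ℂ) ^ (-(t + (d - 1) + r + r')) *
        (betaSqIntegrand (t + r + r') (t / 2 - r - r') s *
          ((l : ℂ) ^ (((d : ℂ) - 1) / 2 + t + r' - 2 * r - 1) *
            (1 - (l : ℂ)) ^ (((d : ℂ) - 1) / 2 + t + r - 2 * r' - 1))) := by
  obtain ⟨h1, h2⟩ := stadeMap_den_pos hs hl
  have h3 := one_sub_sq_mul_pos hs hl
  have h4 : 0 < 1 - s ^ 2 := by nlinarith [hs.1, hs.2]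
  obtain ⟨hs0, hs1⟩ := hs
  obtain ⟨hl0, hl1⟩ := hl
  have hl' : 0 < 1 - l := by linarith
  obtain ⟨e1, e2⟩ := sqrt_one_sub_stadeMap ⟨hs0, hs1⟩ ⟨hl0, hl1⟩
  have hR := Real.sqrt_pos.2 (mul_pos h4 h3)
  have hRsq := Real.mul_self_sqrt (mul_pos h4 h3).le
  have hlogR : Real.log √((1 - s ^ 2) * (1 - s ^ 2 * (2 * l - 1) ^ 2)) =
      (Real.log (1 - s ^ 2) + Real.log (1 - s ^ 2 * (2 * l - 1) ^ 2)) / 2 := by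
    rw [Real.log_sqrt (mul_pos h4 h3).le, Real.log_mul h4.ne' h3.ne']
  have ecot : (1 + halfCot (stadeMap (s, l)).1 * halfCot (stadeMap (s, l)).2) ^ 2 /
      (halfCot (stadeMap (s, l)).1 * halfCot (stadeMap (s, l)).2) = 2 * 2 / (1 - s ^ 2) := by
    have : halfCot (stadeMap (s, l)).1 * halfCot (stadeMap (s, l)).2 =
        (1 + s) ^ 2 / (1 - s ^ 2) := by
      rw [halfCot, halfCot, e1, e2]
      rw [div_mul_div_comm, div_mul_div_comm, hRsq]
      simp only [stadeMap]
      field_simp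
      ring
    rw [this]
    field_simp
    ring
  have esum : 1 / √(1 - (stadeMap (s, l)).1 ^ 2) + 1 / √(1 - (stadeMap (s, l)).2 ^ 2) =
      2 / √((1 - s ^ 2) * (1 - s ^ 2 * (2 * l - 1) ^ 2)) := by
    rw [e1, e2]
    field_simp
    ring
  have esum' : 1 / (stadeMap (s, l)).1 + 1 / (stadeMap (s, l)).2 =
      (1 - s ^ 2 * (2 * l - 1) ^ 2) / (2 * s * l * (1 - l)) := by
    simp only [stadeMap]
    field_simp
    ring
  have c4 : (4 : ℂ) = Complex.exp (Real.log 2 + Real.log 2) := by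
    rw [Complex.exp_add, ← ofReal_eq_exp_log two_pos]; norm_num
  have c2 : ∀ c : ℂ, (2 : ℂ) ^ c = Complex.exp (Real.log 2 * c) := fun c => by
    rw [← ofReal_cpow_eq_exp two_pos, ofReal_ofNat]
  rw [abs_det_fderivStadeMap ⟨hs0, hs1⟩ ⟨hl0, hl1⟩, Complex.real_smul, angularIntegrand,
    angularWeight, ecot, esum, esum', e1, e2, betaSqIntegrand, c2]
  have edet : 4 * s * (1 - s ^ 2) * (1 - s ^ 2 * (2 * l - 1) ^ 2) /
      ((1 + s ^ 2 * (2 * l - 1)) ^ 2 * (1 - s ^ 2 * (2 * l - 1)) ^ 2) =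
      2 * 2 * s * (1 - s ^ 2) * (1 - s ^ 2 * (2 * l - 1) ^ 2) /
      ((1 + s ^ 2 * (2 * l - 1)) * (1 + s ^ 2 * (2 * l - 1)) *
        ((1 - s ^ 2 * (2 * l - 1)) * (1 - s ^ 2 * (2 * l - 1)))) := by ring
  have ez1 : (stadeMap (s, l)).1 = 2 * s * l / (1 + s ^ 2 * (2 * l - 1)) := rfl
  have ez2 : (stadeMap (s, l)).2 = 2 * s * (1 - l) / (1 - s ^ 2 * (2 * l - 1)) := rfl
  have el : (1 - (l : ℂ)) = ((1 - l : ℝ) : ℂ) := by push_cast; ring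
  have fold : (4 : ℂ) ^ d * 2 * Complex.exp (Real.log 2 * (-(t + (d - 1) + r + r'))) *
      (2 * ((1 - s ^ 2 : ℝ) : ℂ) ^ (t + r + r' - 1) *
        (s : ℂ) ^ (2 * (t / 2 - r - r') - 1) *
          ((l : ℂ) ^ (((d : ℂ) - 1) / 2 + t + r' - 2 * r - 1) *
            (1 - (l : ℂ)) ^ (((d : ℂ) - 1) / 2 + t + r - 2 * r' - 1))) =
      (4 : ℂ) ^ d * 4 * Complex.exp (Real.log 2 * (-(t + (d - 1) + r + r'))) *
      (((1 - s ^ 2 : ℝ) : ℂ) ^ (t + r + r' - 1) *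
        (s : ℂ) ^ (2 * (t / 2 - r - r') - 1) *
          ((l : ℂ) ^ (((d : ℂ) - 1) / 2 + t + r' - 2 * r - 1) *
            (1 - (l : ℂ)) ^ (((d : ℂ) - 1) / 2 + t + r - 2 * r' - 1))) := by ring
  rw [fold, edet, ez1, ez2, el, c4]
  generalize √((1 - s ^ 2) * (1 - s ^ 2 * (2 * l - 1) ^ 2)) = R at *
  generalize 1 - s ^ 2 * (2 * l - 1) ^ 2 = V at *
  generalize 1 + s ^ 2 * (2 * l - 1) = P at *
  generalize 1 - s ^ 2 * (2 * l - 1) = N at *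
  generalize 1 - s ^ 2 = U at *
  generalize 1 - l = m at *
  rw [ofReal_eq_exp_log (x := 2 * 2 / U) (by positivity),
    ofReal_eq_exp_log (x := 2 * 2 * s * U * V / (P * P * (N * N))) (by positivity),
    ofReal_cpow_eq_exp (x := R / P) (by positivity),
    ofReal_cpow_eq_exp (x := R / N) (by positivity),
    ofReal_cpow_eq_exp (x := 2 / R) (by positivity),
    ofReal_cpow_eq_exp (x := V / (2 * s * l * m)) (by positivity),
    ofReal_cpow_eq_exp (x := 2 * s * l / P) (by positivity),
    ofReal_cpow_eq_exp (x := 2 * s * m / N) (by positivity),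
    ofReal_cpow_eq_exp h4, ofReal_cpow_eq_exp hs0, ofReal_cpow_eq_exp hl0, ofReal_cpow_eq_exp hl']
  simp only [← Complex.exp_add, ← Complex.exp_nat_mul]
  have n2 : (2 : ℝ) ≠ 0 := two_ne_zero
  have l1 : Real.log (2 * 2 / U) = Real.log 2 + Real.log 2 - Real.log U := by
    rw [Real.log_div (by positivity) (by positivity), Real.log_mul n2 n2]
  have l2 : Real.log (2 * 2 * s * U * V / (P * P * (N * N))) = Real.log 2 + Real.log 2 +
      Real.log s + Real.log U + Real.log V - 2 * Real.log P - 2 * Real.log N := by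
    rw [Real.log_div (by positivity) (by positivity), Real.log_mul (by positivity) (by positivity),
      Real.log_mul (by positivity) (by positivity), Real.log_mul (by positivity) (by positivity),
      Real.log_mul (by positivity) (by positivity), Real.log_mul (by positivity) (by positivity),
      Real.log_mul (by positivity) (by positivity), Real.log_mul (by positivity) (by positivity)]
    ring
  have l3 : Real.log (V / (2 * s * l * m)) =
      Real.log V - Real.log 2 - Real.log s - Real.log l - Real.log m := by
    rw [Real.log_div (by positivity) (by positivity), Real.log_mul (by positivity) (by positivity),
      Real.log_mul (by positivity) (by positivity), Real.log_mul (by positivity) (by positivity)]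
    ring
  have l4 : Real.log (2 * s * l / P) = Real.log 2 + Real.log s + Real.log l - Real.log P := by
    rw [Real.log_div (by positivity) (by positivity), Real.log_mul (by positivity) (by positivity),
      Real.log_mul (by positivity) (by positivity)]
  have l5 : Real.log (2 * s * m / N) = Real.log 2 + Real.log s + Real.log m - Real.log N := by
    rw [Real.log_div (by positivity) (by positivity), Real.log_mul (by positivity) (by positivity),
      Real.log_mul (by positivity) (by positivity)]
  rw [l1, l2, l3, l4, l5, Real.log_div hR.ne' h1.ne', Real.log_div hR.ne' h2.ne',
    Real.log_div n2 hR.ne', hlogR]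
  congr 1
  push_cast
  ring

section

variable {d : ℕ} {r r' : ℂ} {t : ℝ}

theorem integrableOn_betaSqIntegrand_mul_betaIntegrand (hd : 1 ≤ d) (hr : r.re = 0)
    (hr' : r'.re = 0) (ht : 0 < t) :
    IntegrableOn (fun p : ℝ × ℝ => betaSqIntegrand (t + r + r') (t / 2 - r - r') p.1 *
          ((p.2 : ℂ) ^ (((d : ℂ) - 1) / 2 + t + r' - 2 * r - 1) *
            (1 - (p.2 : ℂ)) ^ (((d : ℂ) - 1) / 2 + t + r - 2 * r' - 1)))
      (Set.Ioo (0 : ℝ) 1 ×ˢ Set.Ioo (0 : ℝ) 1) := by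
  have hd' : (1 : ℝ) ≤ d := by exact_mod_cast hd
  have h1 := integrableOn_betaSqIntegrand (p := t + r + r') (q := t / 2 - r - r')
    (by simp [hr, hr', ht]) (by simp [hr, hr', ht])
  have h2 := betaIntegral_convergent (u := ((d : ℂ) - 1) / 2 + t + r' - 2 * r)
    (v := ((d : ℂ) - 1) / 2 + t + r - 2 * r') (by simp [hr, hr']; linarith)
    (by simp [hr, hr']; linarith)
  rw [intervalIntegrable_iff_integrableOn_Ioo_of_le zero_le_one] at h2
  rw [IntegrableOn, Measure.volume_eq_prod, ← Measure.prod_restrict]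
  exact h1.mul_prod h2

theorem integrableOn_angularIntegrand (hd : 1 ≤ d) (hr : r.re = 0) (hr' : r'.re = 0)
    (ht : 0 < t) :
    IntegrableOn (angularIntegrand d r r' t) (Set.Ioo (0 : ℝ) 1 ×ˢ Set.Ioo (0 : ℝ) 1) := by
  rw [← image_stadeMap, integrableOn_image_iff_integrableOn_abs_det_fderiv_smul volume
    (measurableSet_Ioo.prod measurableSet_Ioo)
    (fun p hp => (hasFDerivAt_stadeMap hp.1 hp.2).hasFDerivWithinAt) injOn_stadeMap]
  refine IntegrableOn.congr_fun
    ((integrableOn_betaSqIntegrand_mul_betaIntegrand hd hr hr' ht).const_mul _)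
    (fun p hp => (abs_det_smul_angularIntegrand d r r' t hp.1 hp.2).symm)
    (measurableSet_Ioo.prod measurableSet_Ioo)

theorem integral_angularIntegrand (hd : 1 ≤ d) (hr : r.re = 0) (hr' : r'.re = 0) (ht : 0 < t) :
    ∫ z in Set.Ioo (0 : ℝ) 1 ×ˢ Set.Ioo (0 : ℝ) 1, angularIntegrand d r r' t z =
      4 ^ d * 2 * (2 : ℂ) ^ (-(t + (d - 1) + r + r')) *
        (cBeta (t + r + r') (t / 2 - r - r') *
          cBeta (((d : ℂ) - 1) / 2 + t + r' - 2 * r) (((d : ℂ) - 1) / 2 + t + r - 2 * r')) := by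
  have hd' : (1 : ℝ) ≤ d := by exact_mod_cast hd
  conv_lhs => rw [← image_stadeMap]
  rw [integral_image_eq_integral_abs_det_fderiv_smul volume
    (measurableSet_Ioo.prod measurableSet_Ioo)
    (fun p hp => (hasFDerivAt_stadeMap hp.1 hp.2).hasFDerivWithinAt) injOn_stadeMap,
    setIntegral_congr_fun (measurableSet_Ioo.prod measurableSet_Ioo)
      (fun p hp => abs_det_smul_angularIntegrand d r r' t hp.1 hp.2), integral_const_mul,
    Measure.volume_eq_prod, setIntegral_prod_mul
      (fun s => betaSqIntegrand (t + r + r') (t / 2 - r - r') s)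
      (fun l : ℝ => (l : ℂ) ^ (((d : ℂ) - 1) / 2 + t + r' - 2 * r - 1) *
            (1 - (l : ℂ)) ^ (((d : ℂ) - 1) / 2 + t + r - 2 * r' - 1)),
    integral_betaSqIntegrand (by simp [hr, hr', ht]) (by simp [hr, hr', ht])]
  have hu : 0 < (((d : ℂ) - 1) / 2 + t + r' - 2 * r).re := by simp [hr, hr']; linarith
  have hv : 0 < (((d : ℂ) - 1) / 2 + t + r - 2 * r').re := by simp [hr, hr']; linarith
  congr 2
  rw [cBeta, Gamma_mul_Gamma_eq_betaIntegral hu hv, mul_div_cancel_left₀ _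
    (Complex.Gamma_ne_zero_of_re_pos (by rw [add_re]; linarith)), betaIntegral,
    intervalIntegral.integral_of_le zero_le_one, integral_Ioc_eq_integral_Ioo]

end

/-- The integrand of the zeta integral after inserting the real integral representation of the
Whittaker functions. -/
noncomputable def zetaIntegrand (d : ℕ) (r r' t : ℂ) (y z : ℝ × ℝ) : ℂ :=
  ((1 + (halfCot z.1 * halfCot z.2 : ℝ)) ^ 2 / (halfCot z.1 * halfCot z.2 : ℝ) : ℂ) ^ d *
    (whittakerKernel d r (2 * π * y.1) (2 * π * y.2) z.1 *
      whittakerKernel d r' (2 * π * y.1) (2 * π * y.2) z.2) *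
    ((y.1 ^ 2 * y.2 : ℝ) : ℂ) ^ t / ((y.1 * y.2 : ℝ) : ℂ) ^ 3

theorem zetaIntegrand_eq (d : ℕ) (r r' t : ℂ) {y : ℝ × ℝ} (hy₁ : 0 < y.1) (hy₂ : 0 < y.2)
    (z : ℝ × ℝ) :
    zetaIntegrand d r r' t y z = angularWeight d r r' z * (2 * π) ^ (2 * d + 2) *
      (((y.1 : ℂ) ^ (2 * t + (d - 1) - r - r' - 1) *
        Complex.exp (-((2 * π * (1 / √(1 - z.1 ^ 2) + 1 / √(1 - z.2 ^ 2)) : ℝ) * y.1))) *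
      ((y.2 : ℂ) ^ (t + (d - 1) + r + r' - 1) *
        Complex.exp (-((2 * π * (1 / z.1 + 1 / z.2) : ℝ) * y.2)))) := by
  rcases y with ⟨a, b⟩
  simp only at hy₁ hy₂ ⊢
  have hX : 0 < 2 * π * a := by positivity
  have hY : 0 < 2 * π * b := by positivity
  have h2pi : (0 : ℝ) < 2 * π := by positivity
  have e1 : Complex.exp (-((2 * π * (1 / √(1 - z.1 ^ 2) + 1 / √(1 - z.2 ^ 2)) : ℝ) * a)) =
      Complex.exp (-(2 * π * a / √(1 - z.1 ^ 2) : ℝ)) *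
        Complex.exp (-(2 * π * a / √(1 - z.2 ^ 2) : ℝ)) := by
    rw [← Complex.exp_add]
    congr 1
    push_cast
    ring
  have e2 : Complex.exp (-((2 * π * (1 / z.1 + 1 / z.2) : ℝ) * b)) =
      Complex.exp (-(2 * π * b / z.1 : ℝ)) * Complex.exp (-(2 * π * b / z.2 : ℝ)) := by
    rw [← Complex.exp_add]
    congr 1
    push_cast
    ring
  have e3 : ((2 * π * a : ℝ) : ℂ) ^ (((d : ℂ) - 1) / 2 + 1 - r) *
      ((2 * π * b : ℝ) : ℂ) ^ (((d : ℂ) - 1) / 2 + 1 + r) *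
      (((2 * π * a : ℝ) : ℂ) ^ (((d : ℂ) - 1) / 2 + 1 - r') *
      ((2 * π * b : ℝ) : ℂ) ^ (((d : ℂ) - 1) / 2 + 1 + r')) * ((a ^ 2 * b : ℝ) : ℂ) ^ t =
      (2 * π) ^ (2 * d + 2) * ((a : ℂ) ^ (2 * t + (d - 1) - r - r' - 1) *
        (b : ℂ) ^ (t + (d - 1) + r + r' - 1)) * ((a * b : ℝ) : ℂ) ^ 3 := by
    rw [← ofReal_ofNat 2, ← ofReal_mul, ofReal_eq_exp_log h2pi,
      ofReal_eq_exp_log (mul_pos hy₁ hy₂)]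
    rw [ofReal_cpow_eq_exp hX, ofReal_cpow_eq_exp hX, ofReal_cpow_eq_exp hY,
      ofReal_cpow_eq_exp hY, ofReal_cpow_eq_exp hy₁, ofReal_cpow_eq_exp hy₂,
      ofReal_cpow_eq_exp (x := a ^ 2 * b) (by positivity)]
    simp only [← Complex.exp_add, ← Complex.exp_nat_mul]
    rw [Real.log_mul h2pi.ne' hy₁.ne', Real.log_mul h2pi.ne' hy₂.ne', Real.log_mul hy₁.ne' hy₂.ne',
      Real.log_mul (by positivity) hy₂.ne', Real.log_pow]
    congr 1
    push_cast
    ring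
  have hab : ((a * b : ℝ) : ℂ) ^ 3 ≠ 0 := pow_ne_zero _ (ofReal_ne_zero.2 (mul_pos hy₁ hy₂).ne')
  rw [zetaIntegrand, div_eq_iff hab, e1, e2, angularWeight, whittakerKernel, whittakerKernel]
  rw [show (((1 + halfCot z.1 * halfCot z.2) ^ 2 / (halfCot z.1 * halfCot z.2) : ℝ) : ℂ) =
    ((1 + (halfCot z.1 * halfCot z.2 : ℝ)) ^ 2 / (halfCot z.1 * halfCot z.2 : ℝ) : ℂ) by
      push_cast; rfl]
  simp only
  linear_combination
    (((1 + (halfCot z.1 * halfCot z.2 : ℝ)) ^ 2 / (halfCot z.1 * halfCot z.2 : ℝ) : ℂ) ^ d * 4 *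
    ((√(1 - z.1 ^ 2) : ℝ) : ℂ) ^ (((d : ℂ) - 1) / 2 - 1 + 3 * r) *
    (z.1 : ℂ) ^ (-((d : ℂ) - 1) / 2 - 1 - 3 * r) *
    ((√(1 - z.2 ^ 2) : ℝ) : ℂ) ^ (((d : ℂ) - 1) / 2 - 1 + 3 * r') *
    (z.2 : ℂ) ^ (-((d : ℂ) - 1) / 2 - 1 - 3 * r') *
      (Complex.exp (-(2 * π * a / √(1 - z.1 ^ 2) : ℝ)) *
        Complex.exp (-(2 * π * a / √(1 - z.2 ^ 2) : ℝ))) *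
      (Complex.exp (-(2 * π * b / z.1 : ℝ)) * Complex.exp (-(2 * π * b / z.2 : ℝ)))) * e3

theorem integrableOn_cpow_mul_exp_neg_mul {a : ℂ} (ha : 0 < a.re) {ρ : ℝ} (hρ : 0 < ρ) :
    IntegrableOn (fun x : ℝ => (x : ℂ) ^ (a - 1) * Complex.exp (-(ρ * x))) (Set.Ioi 0) := by
  by_contra h
  have h1 := integral_cpow_mul_exp_neg_mul_Ioi ha hρ
  rw [integral_undef h] at h1
  refine mul_ne_zero ?_ (Complex.Gamma_ne_zero_of_re_pos ha) h1.symm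
  simp [cpow_eq_zero_iff, hρ.ne']

theorem one_div_two_pi_mul_cpow {σ : ℝ} (hσ : 0 < σ) (a : ℂ) :
    (1 / ((2 * π * σ : ℝ) : ℂ)) ^ a = (2 * π : ℂ) ^ (-a) * (σ : ℂ) ^ (-a) := by
  have h : (1 / ((2 * π * σ : ℝ) : ℂ)) = (((2 * π * σ)⁻¹ : ℝ) : ℂ) := by
    rw [ofReal_inv, one_div]
  have h2pi : (0 : ℝ) < 2 * π := by positivity
  rw [h, ofReal_cpow_eq_exp (by positivity), ofReal_cpow_eq_exp hσ, ← ofReal_ofNat 2, ← ofReal_mul,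
    ofReal_cpow_eq_exp h2pi, ← Complex.exp_add, Real.log_inv, Real.log_mul h2pi.ne' hσ.ne']
  congr 1
  push_cast
  ring

theorem norm_whittakerKernel (d : ℕ) {r : ℂ} (hr : r.re = 0) {X Y z : ℝ} (hX : 0 < X) (hY : 0 < Y)
    (hz : z ∈ Set.Ioo (0 : ℝ) 1) :
    (‖whittakerKernel d r X Y z‖ : ℂ) = whittakerKernel d 0 X Y z := by
  have hh := sqrt_one_sub_sq_pos hz
  have key : ∀ {x : ℝ} (_ : 0 < x) {s s' : ℂ}, s' = (s.re : ℂ) →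
      ((‖(x : ℂ) ^ s‖ : ℝ) : ℂ) = (x : ℂ) ^ s' := by
    intro x hx s s' hs
    rw [norm_cpow_eq_rpow_re_of_pos hx, ofReal_cpow hx.le, hs]
  have key' : ∀ x : ℝ, ((‖Complex.exp (-(x : ℂ))‖ : ℝ) : ℂ) = Complex.exp (-(x : ℂ)) := by
    intro x
    rw [← ofReal_neg, ← ofReal_exp, Complex.norm_real, Real.norm_of_nonneg (Real.exp_pos _).le]
  rw [whittakerKernel, whittakerKernel]
  simp only [norm_mul, ofReal_mul, key']
  rw [key hh (s' := ((d : ℂ) - 1) / 2 - 1 + 3 * 0),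
    key hz.1 (s' := -((d : ℂ) - 1) / 2 - 1 - 3 * 0),
    key hX (s' := ((d : ℂ) - 1) / 2 + 1 - 0), key hY (s' := ((d : ℂ) - 1) / 2 + 1 + 0)]
  · simp
  all_goals simp [hr]

section

variable {d : ℕ} {r r' : ℂ} {t : ℝ}

theorem norm_zetaIntegrand (hr : r.re = 0) (hr' : r'.re = 0) {y z : ℝ × ℝ}
    (hy : y ∈ Set.Ioi (0 : ℝ) ×ˢ Set.Ioi (0 : ℝ))
    (hz : z ∈ Set.Ioo (0 : ℝ) 1 ×ˢ Set.Ioo (0 : ℝ) 1) :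
    (‖zetaIntegrand d r r' t y z‖ : ℂ) = zetaIntegrand d 0 0 t y z := by
  obtain ⟨hy₁, hy₂⟩ := hy
  have hy₁ : 0 < y.1 := hy₁
  have hy₂ : 0 < y.2 := hy₂
  obtain ⟨hz₁, hz₂⟩ := hz
  have hC : 0 < halfCot z.1 * halfCot z.2 := mul_pos (halfCot_pos hz₁) (halfCot_pos hz₂)
  have hX : 0 < 2 * π * y.1 := by positivity
  have hY : 0 < 2 * π * y.2 := by positivity
  rw [zetaIntegrand, zetaIntegrand, norm_div, norm_mul, norm_mul, norm_mul]
  simp only [ofReal_div, ofReal_mul, norm_whittakerKernel d hr hX hY hz₁,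
    norm_whittakerKernel d hr' hX hY hz₂]
  have e1 : ((‖((1 + (halfCot z.1 : ℂ) * halfCot z.2) ^ 2 /
      ((halfCot z.1 : ℂ) * halfCot z.2)) ^ d‖ : ℝ) : ℂ) =
      ((1 + (halfCot z.1 : ℂ) * halfCot z.2) ^ 2 / ((halfCot z.1 : ℂ) * halfCot z.2)) ^ d := by
    have : ((1 + (halfCot z.1 : ℂ) * halfCot z.2) ^ 2 / ((halfCot z.1 : ℂ) * halfCot z.2)) ^ d =
      ((((1 + halfCot z.1 * halfCot z.2) ^ 2 / (halfCot z.1 * halfCot z.2)) ^ d : ℝ) : ℂ) := by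
      push_cast; rfl
    rw [this, Complex.norm_real, Real.norm_of_nonneg (by positivity)]
  have e2 : ((‖((y.1 : ℂ) * y.2) ^ 3‖ : ℝ) : ℂ) = ((y.1 : ℂ) * y.2) ^ 3 := by
    rw [← ofReal_mul, ← ofReal_pow, Complex.norm_real, Real.norm_of_nonneg (by positivity)]
  have e3 : ((‖((y.1 ^ 2 : ℝ) * (y.2 : ℂ)) ^ (t : ℂ)‖ : ℝ) : ℂ) =
      ((y.1 ^ 2 : ℝ) * (y.2 : ℂ)) ^ (t : ℂ) := by
    rw [← ofReal_mul, ← ofReal_cpow (by positivity), Complex.norm_real,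
      Real.norm_of_nonneg (by positivity)]
  rw [e1, e2, e3]

theorem integrableOn_zetaIntegrand_left (hd : 1 ≤ d) (hr : r.re = 0) (hr' : r'.re = 0)
    (ht : 0 < t) {z : ℝ × ℝ} (hz : z ∈ Set.Ioo (0 : ℝ) 1 ×ˢ Set.Ioo (0 : ℝ) 1) :
    IntegrableOn (fun y => zetaIntegrand d r r' t y z) (Set.Ioi (0 : ℝ) ×ˢ Set.Ioi (0 : ℝ)) := by
  have hd' : (1 : ℝ) ≤ d := by exact_mod_cast hd
  have p1 := sqrt_one_sub_sq_pos hz.1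
  have p2 := sqrt_one_sub_sq_pos hz.2
  have p3 := hz.1.1
  have p4 := hz.2.1
  refine IntegrableOn.congr_fun ?_
    (fun y hy => (zetaIntegrand_eq d r r' t hy.1 hy.2 z).symm)
    (measurableSet_Ioi.prod measurableSet_Ioi)
  rw [IntegrableOn, Measure.volume_eq_prod, ← Measure.prod_restrict]
  refine Integrable.const_mul (Integrable.mul_prod
    (integrableOn_cpow_mul_exp_neg_mul (a := 2 * t + (d - 1) - r - r') ?_ ?_)
    (integrableOn_cpow_mul_exp_neg_mul (a := t + (d - 1) + r + r') ?_ ?_)) _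
  · simp [hr, hr']; linarith
  · positivity
  · simp [hr, hr']; linarith
  · positivity

theorem integral_zetaIntegrand_left (hd : 1 ≤ d) (hr : r.re = 0) (hr' : r'.re = 0)
    (ht : 0 < t) {z : ℝ × ℝ} (hz : z ∈ Set.Ioo (0 : ℝ) 1 ×ˢ Set.Ioo (0 : ℝ) 1) :
    ∫ y in Set.Ioi (0 : ℝ) ×ˢ Set.Ioi (0 : ℝ), zetaIntegrand d r r' t y z =
      (2 * π) ^ (2 * d + 2) * (2 * π : ℂ) ^ (-(2 * t + (d - 1) - r - r' : ℂ)) *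
        (2 * π : ℂ) ^ (-(t + (d - 1) + r + r' : ℂ)) *
        Complex.Gamma (2 * t + (d - 1) - r - r') * Complex.Gamma (t + (d - 1) + r + r') *
        angularIntegrand d r r' t z := by
  have hd' : (1 : ℝ) ≤ d := by exact_mod_cast hd
  have p1 := sqrt_one_sub_sq_pos hz.1
  have p2 := sqrt_one_sub_sq_pos hz.2
  have p3 := hz.1.1
  have p4 := hz.2.1
  have a1 : 0 < (2 * (t : ℂ) + (d - 1) - r - r').re := by simp [hr, hr']; linarith
  have a2 : 0 < ((t : ℂ) + (d - 1) + r + r').re := by simp [hr, hr']; linarith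
  have q1 : 0 < 1 / √(1 - z.1 ^ 2) + 1 / √(1 - z.2 ^ 2) := by positivity
  have q2 : 0 < 1 / z.1 + 1 / z.2 := by positivity
  rw [setIntegral_congr_fun (measurableSet_Ioi.prod measurableSet_Ioi)
    (fun (y : ℝ × ℝ) (hy : y ∈ Set.Ioi (0 : ℝ) ×ˢ Set.Ioi (0 : ℝ)) =>
      zetaIntegrand_eq d r r' t hy.1 hy.2 z), integral_const_mul,
    Measure.volume_eq_prod, setIntegral_prod_mul
      (fun y : ℝ => (y : ℂ) ^ (2 * (t : ℂ) + (d - 1) - r - r' - 1) *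
        Complex.exp (-((2 * π * (1 / √(1 - z.1 ^ 2) + 1 / √(1 - z.2 ^ 2)) : ℝ) * y)))
      (fun y : ℝ => (y : ℂ) ^ ((t : ℂ) + (d - 1) + r + r' - 1) *
        Complex.exp (-((2 * π * (1 / z.1 + 1 / z.2) : ℝ) * y))),
    integral_cpow_mul_exp_neg_mul_Ioi a1 (by positivity),
    integral_cpow_mul_exp_neg_mul_Ioi a2 (by positivity), one_div_two_pi_mul_cpow q1,
    one_div_two_pi_mul_cpow q2, angularIntegrand]
  ring

theorem measurable_zetaIntegrand :
    Measurable (Function.uncurry (zetaIntegrand d r r' t)) := by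
  unfold zetaIntegrand whittakerKernel halfCot Function.uncurry
  fun_prop

theorem integrable_zetaIntegrand (hd : 1 ≤ d) (hr : r.re = 0) (hr' : r'.re = 0) (ht : 0 < t) :
    Integrable (Function.uncurry (zetaIntegrand d r r' t))
      ((volume.restrict (Set.Ioi (0 : ℝ) ×ˢ Set.Ioi (0 : ℝ))).prod
        (volume.restrict (Set.Ioo (0 : ℝ) 1 ×ˢ Set.Ioo (0 : ℝ) 1))) := by
  refine (integrable_prod_iff' measurable_zetaIntegrand.aestronglyMeasurable).2 ⟨?_, ?_⟩
  · refine (ae_restrict_iff' (measurableSet_Ioo.prod measurableSet_Ioo)).2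
      (Filter.Eventually.of_forall fun z hz => ?_)
    exact integrableOn_zetaIntegrand_left hd hr hr' ht hz
  · have h := ((integrableOn_angularIntegrand (r := 0) (r' := 0) hd zero_re zero_re ht).const_mul
      ((2 * π) ^ (2 * d + 2) * (2 * π : ℂ) ^ (-(2 * t + (d - 1) - 0 - 0 : ℂ)) *
        (2 * π : ℂ) ^ (-(t + (d - 1) + 0 + 0 : ℂ)) *
        Complex.Gamma (2 * t + (d - 1) - 0 - 0) * Complex.Gamma (t + (d - 1) + 0 + 0))).re
    refine IntegrableOn.congr_fun (s := Set.Ioo (0 : ℝ) 1 ×ˢ Set.Ioo (0 : ℝ) 1) h (fun z hz => ?_)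
      (measurableSet_Ioo.prod measurableSet_Ioo)
    simp only [Function.uncurry]
    rw [← integral_zetaIntegrand_left hd zero_re zero_re ht hz,
      ← setIntegral_congr_fun (measurableSet_Ioi.prod measurableSet_Ioi)
        (fun y hy => norm_zetaIntegrand (d := d) (t := t) hr hr' hy hz), integral_complex_ofReal]
    exact ofReal_re _

theorem Psi_eq_integral_angularIntegrand (hd : 1 ≤ d) (hr : r.re = 0) (hr' : r'.re = 0)
    (ht : 0 < t) :
    Psi d r r' t = ((2 : ℂ) ^ (d + 1) * (Real.pi : ℂ))⁻¹ ^ 2 *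
      ((2 * π) ^ (2 * d + 2) * (2 * π : ℂ) ^ (-(2 * t + (d - 1) - r - r' : ℂ)) *
        (2 * π : ℂ) ^ (-(t + (d - 1) + r + r' : ℂ)) *
        Complex.Gamma (2 * t + (d - 1) - r - r') * Complex.Gamma (t + (d - 1) + r + r') *
        ∫ z in Set.Ioo (0 : ℝ) 1 ×ˢ Set.Ioo (0 : ℝ) 1, angularIntegrand d r r' t z) := by
  have hint := integrable_zetaIntegrand hd hr hr' ht
  have hleft := hint.integral_prod_left
  rw [← integral_const_mul, ← setIntegral_congr_fun (measurableSet_Ioo.prod measurableSet_Ioo)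
    (fun z hz => integral_zetaIntegrand_left hd hr hr' ht hz), ← integral_integral_swap hint,
    ← integral_const_mul, Psi]
  have hprod := setIntegral_prod (μ := (volume : Measure ℝ)) (ν := (volume : Measure ℝ))
    (s := Set.Ioi (0 : ℝ)) (t := Set.Ioi (0 : ℝ)) _
    (hleft.const_mul (((2 : ℂ) ^ (d + 1) * (Real.pi : ℂ))⁻¹ ^ 2))
  refine Eq.trans ?_ hprod.symm
  refine setIntegral_congr_fun measurableSet_Ioi fun y₁ hy₁ =>
    setIntegral_congr_fun measurableSet_Ioi fun y₂ hy₂ => ?_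
  rw [sum_Wstar_mul_Wstar hd hr hr' hy₁ hy₂, mul_assoc, mul_div_assoc, ← integral_mul_const,
    ← integral_div]
  rfl

end

theorem stade_constant (d : ℕ) (r r' t : ℂ) :
    ((2 : ℂ) ^ (d + 1) * (Real.pi : ℂ))⁻¹ ^ 2 *
      ((2 * π) ^ (2 * d + 2) * (2 * π : ℂ) ^ (-(2 * t + (d - 1) - r - r')) *
        (2 * π : ℂ) ^ (-(t + (d - 1) + r + r')) *
        (4 ^ d * 2 * (2 : ℂ) ^ (-(t + (d - 1) + r + r')))) =
      (2 : ℂ) ^ (4 - (d : ℂ) - 4 * t - r - r') * (Real.pi : ℂ) ^ (2 - 3 * t) := by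
  have hpi := ofReal_eq_exp_log Real.pi_pos
  have h2 : (2 : ℂ) = Complex.exp (Real.log 2) := by
    rw [← ofReal_eq_exp_log two_pos, ofReal_ofNat]
  have h4 : (4 : ℂ) = Complex.exp (Real.log 2 + Real.log 2) := by
    rw [Complex.exp_add, ← h2]; norm_num
  have h2pi : (2 * π : ℂ) = Complex.exp (Real.log 2 + Real.log π) := by
    rw [Complex.exp_add, ← h2, ← hpi]
  have c2 : ∀ c : ℂ, (2 : ℂ) ^ c = Complex.exp (Real.log 2 * c) := fun c => by
    rw [← ofReal_cpow_eq_exp two_pos, ofReal_ofNat]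
  have cpi : ∀ c : ℂ, (π : ℂ) ^ c = Complex.exp (Real.log π * c) :=
    ofReal_cpow_eq_exp Real.pi_pos
  have c2pi : ∀ c : ℂ, (2 * π : ℂ) ^ c = Complex.exp ((Real.log 2 + Real.log π) * c) := fun c => by
    rw [← ofReal_ofNat 2, ← ofReal_mul, ofReal_cpow_eq_exp (by positivity),
      Real.log_mul two_ne_zero Real.pi_ne_zero, ofReal_add]
  have k1 : ((2 : ℂ) ^ (d + 1) * (Real.pi : ℂ))⁻¹ ^ 2 =
      Complex.exp (-2 * ((d + 1) * Real.log 2 + Real.log π)) := by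
    rw [show (-2 : ℂ) * ((d + 1) * Real.log 2 + Real.log π) =
      ((2 : ℕ) : ℂ) * (-(((d + 1 : ℕ) : ℂ) * Real.log 2 + Real.log π)) by push_cast; ring,
      Complex.exp_nat_mul, Complex.exp_neg, Complex.exp_add, Complex.exp_nat_mul, ← h2, ← hpi]
  have k2 : (2 * π : ℂ) ^ (2 * d + 2) =
      Complex.exp ((2 * d + 2) * (Real.log 2 + Real.log π)) := by
    rw [show (2 * (d : ℂ) + 2) * (Real.log 2 + Real.log π) =
      ((2 * d + 2 : ℕ) : ℂ) * (Real.log 2 + Real.log π) by push_cast; ring,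
      Complex.exp_nat_mul, ← h2pi]
  have k3 : (4 : ℂ) ^ d * 2 = Complex.exp (d * (Real.log 2 + Real.log 2) + Real.log 2) := by
    rw [Complex.exp_add, Complex.exp_nat_mul, ← h4, ← h2]
  rw [k1, k2, k3, c2pi, c2pi, c2, c2, cpi]
  simp only [← Complex.exp_add]
  congr 1
  ring

/-- Stade's formula for generalized principal series Whittaker functions on `GL(3)`. -/
theorem stade_formula (d : ℕ) (hd : 2 ≤ d) (r r' : ℂ) (hr : r.re = 0) (hr' : r'.re = 0)
    (t : ℝ) (ht : 0 < t) :
    Psi d r r' (t : ℂ) =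
      (2 : ℂ) ^ (4 - (d : ℂ) - 4 * (t : ℂ) - r - r') * (Real.pi : ℂ) ^ (2 - 3 * (t : ℂ)) *
        Complex.Gamma ((t : ℂ) + r + r') *
          Complex.Gamma (((d : ℂ) - 1) / 2 + (t : ℂ) + r - 2 * r') *
            Complex.Gamma (((d : ℂ) - 1) / 2 + (t : ℂ) + r' - 2 * r) *
              Complex.Gamma ((d : ℂ) - 1 + (t : ℂ) + r + r') *
                Complex.Gamma ((t : ℂ) / 2 - r - r') / Complex.Gamma (3 * (t : ℂ) / 2) := by
  have hd1 : 1 ≤ d := by omega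
  have hd' : (1 : ℝ) ≤ d := by exact_mod_cast hd1
  have hne : Complex.Gamma (2 * (t : ℂ) + (d - 1) - r - r') ≠ 0 :=
    Complex.Gamma_ne_zero_of_re_pos (by simp [hr, hr']; linarith)
  rw [Psi_eq_integral_angularIntegrand hd1 hr hr' ht,
    integral_angularIntegrand hd1 hr hr' ht, ← stade_constant, cBeta, cBeta,
    show (t : ℂ) + r + r' + (t / 2 - r - r') = 3 * t / 2 by ring,
    show ((d : ℂ) - 1) / 2 + t + r' - 2 * r + (((d : ℂ) - 1) / 2 + t + r - 2 * r') =
      2 * t + (d - 1) - r - r' by ring,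
    show (t : ℂ) + ((d : ℂ) - 1) + r + r' = (d : ℂ) - 1 + t + r + r' by ring]
  field_simp
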